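/- Let X be a compact Hausdorff space and A = C(X, ℝ) (or C(X, ℂ)). Suppose tsr A ≤ n, i.e., the tuples (f₁,...,fₙ) with no common zero are dense in Aⁿ. Then for every invertible (n+1)-tuple (f, g) ∈ Aⁿ × A (no common zero of f₁,...,fₙ,g) and every ε > 0, there exists a ∈ Aⁿ with ‖a_j‖_∞ ≤ ε for all j such that the functions f₁ + a₁g, ..., fₙ + aₙg have no common zero on X. -/

import Mathlib

/-- A nowhere zero pair, consisting of a finite tuple of continuous functions and a further
continuous function on a compact space, is uniformly bounded away from zero. -/
theorem exists_pos_forall_exists_le_norm_or_le_norm {𝕜 X ι : Type*} [NormedField 𝕜]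
    [TopologicalSpace X] [CompactSpace X] [Fintype ι] (f : ι → C(X, 𝕜)) (g : C(X, 𝕜))
    (hfg : ∀ x : X, (∃ j, f j x ≠ 0) ∨ g x ≠ 0) :
    ∃ δ : ℝ, 0 < δ ∧ ∀ x, (∃ j, δ ≤ ‖f j x‖) ∨ δ ≤ ‖g x‖ := by
  have hcont : Continuous fun x => max ‖fun j => f j x‖ ‖g x‖ := by fun_prop
  have hpos : ∀ x ∈ Set.univ, 0 < max ‖fun j => f j x‖ ‖g x‖ := by
    rintro x -
    rcases hfg x with ⟨j, hj⟩ | h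
    · exact lt_max_of_lt_left ((norm_pos_iff.2 hj).trans_le (norm_le_pi_norm (fun j => f j x) j))
    · exact lt_max_of_lt_right (norm_pos_iff.2 h)
  obtain ⟨δ, hδ, h⟩ := isCompact_univ.exists_forall_le' hcont.continuousOn hpos
  refine ⟨δ, hδ, fun x => ?_⟩
  by_contra! hx
  exact (h x (Set.mem_univ x)).not_gt (max_lt ((pi_norm_lt_iff hδ).2 hx.1) hx.2)


/-- For `A = C(X, 𝕜)` with `X` compact Hausdorff: if the invertible `n`-tuples (no common
zero) are dense in `Aⁿ` (`tsr A ≤ n`), then for every invertible `(n+1)`-tuple `(f, g)` and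
every `ε > 0` there is `a ∈ Aⁿ` with `‖a_j‖_∞ ≤ ε` such that `f + a·g` has no common zero. -/
theorem stmt6 (𝕜 : Type*) [RCLike 𝕜] (X : Type*) [TopologicalSpace X] [CompactSpace X]
    [T2Space X] (n : ℕ)
    (htsr : Dense {f : Fin n → C(X, 𝕜) | ∀ x : X, ∃ j, f j x ≠ 0})
    (f : Fin n → C(X, 𝕜)) (g : C(X, 𝕜))
    (hfg : ∀ x : X, (∃ j, f j x ≠ 0) ∨ g x ≠ 0)
    (ε : ℝ) (hε : 0 < ε) :
    ∃ a : Fin n → C(X, 𝕜), (∀ j, ‖a j‖ ≤ ε) ∧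
      ∀ x : X, ∃ j, (f j + a j * g) x ≠ 0 := by
  obtain ⟨δ, hδ, hbound⟩ := exists_pos_forall_exists_le_norm_or_le_norm f g hfg
  obtain ⟨η, hη, hηmin⟩ := exists_between (lt_min hδ (mul_pos hε hδ))
  have hηδ : η < δ := hηmin.trans_le (min_le_left _ _)
  have hηε : η ≤ ε * δ := (hηmin.trans_le (min_le_right _ _)).le
  obtain ⟨h, hh, hdist⟩ := htsr.exists_dist_lt f hη
  have hu : ∀ j x, ‖h j x - f j x‖ ≤ η := fun j x => by
    rw [← dist_eq_norm, dist_comm]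
    exact (ContinuousMap.dist_apply_le_dist x).trans ((dist_le_pi_dist f h j).trans hdist.le)
  have hm : ∀ x, 0 < max (‖g x‖ ^ 2) (δ ^ 2) := fun x => lt_max_of_lt_right (by positivity)
  -- `k` agrees with `1 / g` where `δ ≤ ‖g‖`.
  let k : C(X, 𝕜) :=
    ⟨fun x => star (g x) * (((max (‖g x‖ ^ 2) (δ ^ 2))⁻¹ : ℝ) : 𝕜), by
      refine (by fun_prop : Continuous fun x => star (g x)).mul
        (RCLike.continuous_ofReal.comp (Continuous.inv₀ (by fun_prop) fun x => (hm x).ne'))⟩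
  have hk : ∀ x, ‖k x‖ = ‖g x‖ / max (‖g x‖ ^ 2) (δ ^ 2) := fun x => by
    simp only [k, ContinuousMap.coe_mk, norm_mul, norm_star, RCLike.norm_ofReal,
      abs_of_pos (inv_pos.2 (hm x)), div_eq_mul_inv]
  have hkδ : ∀ x, ‖k x‖ ≤ δ⁻¹ := fun x => by
    rw [hk, div_le_iff₀ (hm x), inv_mul_eq_div, le_div_iff₀ hδ]
    rcases le_total ‖g x‖ δ with hx | hx
    · exact le_max_of_le_right (by nlinarith)
    · exact le_max_of_le_left (by nlinarith [norm_nonneg (g x)])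
  have hkg : ∀ x, ‖k x * g x‖ ≤ 1 := fun x => by
    rw [norm_mul, hk, div_mul_eq_mul_div, div_le_one (hm x), ← sq]
    exact le_max_left _ _
  have hkinv : ∀ x, δ ≤ ‖g x‖ → k x * g x = 1 := fun x hx => by
    have hg : g x ≠ 0 := norm_pos_iff.1 (hδ.trans_le hx)
    have hg' : ((‖g x‖ : ℝ) : 𝕜) ≠ 0 := by simpa using hg
    simp only [k, ContinuousMap.coe_mk]
    rw [max_eq_left (by gcongr), mul_right_comm, RCLike.star_def, RCLike.conj_mul]
    push_cast
    exact mul_inv_cancel₀ (pow_ne_zero 2 hg')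
  refine ⟨fun j => (h j - f j) * k, fun j => ?_, fun x => ?_⟩
  · refine (ContinuousMap.norm_le _ hε.le).2 fun x => ?_
    calc ‖((h j - f j) * k) x‖ = ‖h j x - f j x‖ * ‖k x‖ := by simp
      _ ≤ ε * δ * δ⁻¹ := mul_le_mul ((hu j x).trans hηε) (hkδ x) (norm_nonneg _) (by positivity)
      _ = ε := mul_inv_cancel_right₀ hδ.ne' ε
  · have happ : ∀ j, (f j + (h j - f j) * k * g) x =
        f j x + (h j x - f j x) * (k x * g x) := fun j => by simp [mul_assoc]
    simp only [happ]
    rcases hbound x with ⟨j, hj⟩ | hx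
    · refine ⟨j, fun h0 => ?_⟩
      have : ‖f j x‖ ≤ η := by
        rw [eq_neg_of_add_eq_zero_left h0, norm_neg, norm_mul]
        exact (mul_le_of_le_one_right (norm_nonneg _) (hkg x)).trans (hu j x)
      linarith
    · simpa [hkinv x hx] using hh x
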